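/- There exists an absolute constant C such that for every integer m > C, there is no triple of positive integers (a, b, c) with gcd(a, b, c) = 1 such that the ternary m-gonal form Δ_{m,(a,b,c)}(x,y,z) = a·p_m(x) + b·p_m(y) + c·p_m(z) is regular, i.e., represents over ℤ every rational number it represents over ℤ_p for all primes p (including p = ∞, i.e., over ℝ). -/

import Mathlib

/-- The prime case: a point on a conic modulo `p` off finitely many bad points. -/
lemma key_prime (p : ℕ) (hp : p.Prime) (hK : 13 < p) (a b : ℤ) (ha : ¬ (p : ℤ) ∣ a)
    (hb : ¬ (p : ℤ) ∣ b) :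
    ∃ x y : ℤ, (p : ℤ) ∣ a * (x * (x + 1)) + b * (y * (y + 1)) ∧
      (¬ (p : ℤ) ∣ x ∧ ¬ (p : ℤ) ∣ x + 1) ∧
      ¬ (p : ℤ) ∣ 2 * x + 1 ∧ ¬ (p : ℤ) ∣ 2 * y + 1 := by
  have : Fact p.Prime := ⟨hp⟩
  have ha' : (a : ZMod p) ≠ 0 := by rwa [Ne, ZMod.intCast_zmod_eq_zero_iff_dvd]
  have hb' : (b : ZMod p) ≠ 0 := by rwa [Ne, ZMod.intCast_zmod_eq_zero_iff_dvd]
  set A : ZMod p := (a : ZMod p) with hA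
  set B : ZMod p := (b : ZMod p) with hB
  have quad : ∀ α β γ : ZMod p, (α ≠ 0 ∨ β ≠ 0 ∨ γ ≠ 0) →
      ∃ S : Finset (ZMod p), S.card ≤ 2 ∧ ∀ s, α * s ^ 2 + β * s + γ = 0 → s ∈ S := by
    intro α β γ h
    set P : Polynomial (ZMod p) :=
      Polynomial.C α * Polynomial.X ^ 2 + Polynomial.C β * Polynomial.X + Polynomial.C γ with hP
    have hP0 : P ≠ 0 := by
      intro h0
      have h2 : P.coeff 2 = α := by simp [hP, Polynomial.coeff_X, Polynomial.coeff_C]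
      have h1 : P.coeff 1 = β := by simp [hP, Polynomial.coeff_X, Polynomial.coeff_C]
      have h00 : P.coeff 0 = γ := by simp [hP]
      rw [h0] at h2 h1 h00
      simp at h2 h1 h00
      rcases h with h | h | h
      · exact h h2.symm
      · exact h h1.symm
      · exact h h00.symm
    refine ⟨P.roots.toFinset, ?_, ?_⟩
    · calc P.roots.toFinset.card ≤ Multiset.card P.roots := Multiset.toFinset_card_le _
        _ ≤ P.natDegree := Polynomial.card_roots' _
        _ ≤ 2 := Polynomial.natDegree_quadratic_le
    · intro s hs
      rw [Multiset.mem_toFinset, Polynomial.mem_roots hP0]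
      simp [hP, Polynomial.IsRoot, hs]
  obtain ⟨S1, c1, h1⟩ := quad B 0 A (Or.inl hb')
  obtain ⟨S2, c2, h2⟩ := quad 0 B A (Or.inr (Or.inl hb'))
  obtain ⟨S3, c3, h3⟩ := quad 1 (-1) 0 (Or.inl one_ne_zero)
  obtain ⟨S4, c4, h4⟩ := quad B (-2 * B) (-A) (Or.inl hb')
  obtain ⟨S5, c5, h5⟩ := quad (-B) (-2 * A) A (Or.inl (neg_ne_zero.mpr hb'))
  have hcard : (S1 ∪ S2 ∪ S3 ∪ S4 ∪ S5).card < (Finset.univ : Finset (ZMod p)).card := by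
    rw [Finset.card_univ, ZMod.card]
    have e1 := Finset.card_union_le S1 S2
    have e2 := Finset.card_union_le (S1 ∪ S2) S3
    have e3 := Finset.card_union_le (S1 ∪ S2 ∪ S3) S4
    have e4 := Finset.card_union_le (S1 ∪ S2 ∪ S3 ∪ S4) S5
    omega
  obtain ⟨s, -, hs⟩ := Finset.exists_mem_notMem_of_card_lt_card hcard
  simp only [Finset.mem_union, not_or] at hs
  obtain ⟨⟨⟨⟨n1, n2⟩, n3⟩, n4⟩, n5⟩ := hs
  have d1 : A + B * s ^ 2 ≠ 0 := fun h => n1 (h1 s (by linear_combination h))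
  have d2 : A + B * s ≠ 0 := fun h => n2 (h2 s (by linear_combination h))
  have d3 : s * (s - 1) ≠ 0 := fun h => n3 (h3 s (by linear_combination h))
  have d4 : B * s ^ 2 - 2 * B * s - A ≠ 0 := fun h => n4 (h4 s (by linear_combination h))
  have d5 : A - 2 * A * s - B * s ^ 2 ≠ 0 := fun h => n5 (h5 s (by linear_combination h))
  obtain ⟨w, hw⟩ : ∃ w, (A + B * s ^ 2) * w = 1 := ⟨_, mul_inv_cancel₀ d1⟩
  obtain ⟨x, hx⟩ := ZMod.intCast_surjective (-(A + B * s) * w)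
  obtain ⟨y, hy⟩ := ZMod.intCast_surjective (-(A + B * s) * w * s)
  have hw0 : w ≠ 0 := by rintro rfl; simp at hw
  refine ⟨x, y, ?_, ⟨?_, ?_⟩, ?_, ?_⟩
  all_goals
    rw [← ZMod.intCast_zmod_eq_zero_iff_dvd]
    push_cast
    try rw [hx]
    try rw [hy]
    try rw [← hA]
    try rw [← hB]
  · linear_combination (A + B * s) ^ 2 * w * hw
  · exact mul_ne_zero (neg_ne_zero.mpr d2) hw0
  · intro h
    have : B * (s * (s - 1)) * w = 0 := by linear_combination h + hw
    exact (mul_ne_zero (mul_ne_zero hb' d3) hw0) this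
  · intro h
    have : (B * s ^ 2 - 2 * B * s - A) * w = 0 := by linear_combination h + hw
    exact (mul_ne_zero d4 hw0) this
  · intro h
    have : (A - 2 * A * s - B * s ^ 2) * w = 0 := by linear_combination h + hw
    exact (mul_ne_zero d5 hw0) this

lemma key_all (K : ℕ) (hK : 13 < K) (a b c : ℤ) :
    ∃ x y z : ℤ, (K : ℤ) ∣ a * (x * (x + 1)) + b * (y * (y + 1)) + c * (z * (z + 1)) ∧
      ((¬ (K : ℤ) ∣ x ∧ ¬ (K : ℤ) ∣ x + 1) ∨ (¬ (K : ℤ) ∣ y ∧ ¬ (K : ℤ) ∣ y + 1)) ∧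
      ¬ (K : ℤ) ∣ 2 * x + 1 ∧ ¬ (K : ℤ) ∣ 2 * y + 1 ∧ ¬ (K : ℤ) ∣ 2 * z + 1 := by
  have small : ∀ i : ℤ, 0 < i → i < 14 → ¬ (K : ℤ) ∣ i := by
    intro i h0 h1 h
    have := Int.le_of_dvd h0 h
    omega
  by_cases hp : K.Prime
  · by_cases ha : (K : ℤ) ∣ a
    · refine ⟨1, 0, 0, ?_, Or.inl ⟨?_, ?_⟩, ?_, ?_, ?_⟩
      · simpa using ha.mul_right 2
      all_goals exact small _ (by norm_num) (by norm_num)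
    by_cases hb : (K : ℤ) ∣ b
    · refine ⟨0, 1, 0, ?_, Or.inr ⟨?_, ?_⟩, ?_, ?_, ?_⟩
      · simpa using hb.mul_right 2
      all_goals exact small _ (by norm_num) (by norm_num)
    obtain ⟨x, y, h1, h2, h3, h4⟩ := key_prime K hp hK a b ha hb
    exact ⟨x, y, 0, by simpa using h1, Or.inl h2, h3, h4, small _ (by norm_num) (by norm_num)⟩
  · obtain ⟨p, hpp, N, rfl⟩ := Nat.exists_prime_and_dvd (show K ≠ 1 by omega)
    have hpu : ¬ (p : ℤ) ∣ 1 := by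
      intro h
      have := Int.natCast_dvd_natCast.mp (by simpa using h : (p : ℤ) ∣ ((1 : ℕ) : ℤ))
      exact hpp.one_lt.ne' (Nat.dvd_one.mp this)
    have hpZ : Prime (p : ℤ) := Nat.prime_iff_prime_int.mp hpp
    have hN0 : (N : ℤ) ≠ 0 := by rintro h; simp at h; subst h; simp at hK
    have hpK : (p : ℤ) ∣ ((p * N : ℕ) : ℤ) := ⟨N, by push_cast; ring⟩
    have hNK : (N : ℤ) ∣ ((p * N : ℕ) : ℤ) := ⟨p, by push_cast; ring⟩
    by_cases hpN : p ∣ N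
    · have hpN' : (p : ℤ) ∣ (N : ℤ) := Int.natCast_dvd_natCast.mpr hpN
      obtain ⟨N', hN'⟩ := hpN'
      have odd2 : ∀ t : ℤ, ¬ ((p * N : ℕ) : ℤ) ∣ 2 * (N * t) + 1 := by
        intro t h
        apply hpu
        have h1 := hpK.trans h
        have : (1 : ℤ) = (2 * (N * t) + 1) - p * (2 * N' * t) := by rw [hN']; ring
        rw [this]
        exact dvd_sub h1 (dvd_mul_right _ _)
      have nontriv : ∀ t : ℤ, ¬ (p : ℤ) ∣ t →
          (¬ ((p * N : ℕ) : ℤ) ∣ N * t ∧ ¬ ((p * N : ℕ) : ℤ) ∣ N * t + 1) := by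
        intro t ht
        constructor
        · intro h
          apply ht
          push_cast at h
          rw [mul_comm] at h
          exact (mul_dvd_mul_iff_left hN0).mp h
        · intro h
          apply hpu
          have h1 := hpK.trans h
          have : (1 : ℤ) = (N * t + 1) - p * (N' * t) := by rw [hN']; ring
          rw [this]
          exact dvd_sub h1 (dvd_mul_right _ _)
      by_cases ha : (p : ℤ) ∣ a
      · obtain ⟨a', rfl⟩ := ha
        refine ⟨N * 1, N * 0, N * 0, ⟨a' * (N + 1), ?_⟩, Or.inl (nontriv 1 hpu), odd2 1,
          odd2 0, odd2 0⟩
        push_cast; ring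
      · refine ⟨N * (-b), N * a, N * 0, ⟨N' * (a * b ^ 2 + b * a ^ 2), ?_⟩,
          Or.inr (nontriv a ha), odd2 _, odd2 _, odd2 _⟩
        push_cast
        have : (N : ℤ) * N = p * N * N' := by nth_rewrite 2 [hN']; ring
        linear_combination (a * b ^ 2 + b * a ^ 2) * this
    · have hco : IsCoprime (p : ℤ) (N : ℤ) :=
        Nat.isCoprime_iff_coprime.mpr ((Nat.Prime.coprime_iff_not_dvd hpp).mpr hpN)
      obtain ⟨r, s, hrs⟩ := hco
      have hN1 : ¬ (N : ℤ) ∣ 1 := by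
        intro h
        have := Int.natCast_dvd_natCast.mp (by simpa using h : (N : ℤ) ∣ ((1 : ℕ) : ℤ))
        rw [Nat.dvd_one] at this
        subst this
        simp [hpp] at hp
      refine ⟨-(r * p), 0, 0, ⟨-(a * r * s), ?_⟩, Or.inl ⟨?_, ?_⟩, ?_, ?_, ?_⟩
      · push_cast; linear_combination a * r * p * hrs
      · intro h
        apply hN1
        have h1 := hNK.trans h
        rw [← hrs]
        exact dvd_add ((dvd_neg).mp h1) (dvd_mul_left _ _)
      · intro h
        apply hpu
        have h1 := hpK.trans h
        have := dvd_add h1 (dvd_mul_left (p : ℤ) r)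
        simpa using this
      · intro h
        apply hpu
        have h1 := hpK.trans h
        have := dvd_add h1 (dvd_mul_left (p : ℤ) (2 * r))
        have e : (2 * -(r * (p : ℤ)) + 1) + 2 * r * p = 1 := by ring
        rwa [e] at this
      · exact small _ (by norm_num) (by norm_num)
      · exact small _ (by norm_num) (by norm_num)

/-- A single term over the integers of the segment is nonpositive. -/
lemma term_nonpos (M u : ℤ) (h0 : 0 ≤ u) (h1 : u ≤ M - 2) : u * (u + 2 - M) ≤ 0 :=
  mul_nonpos_of_nonneg_of_nonpos h0 (by linarith)

lemma sum_neg (M u1 u2 u3 : ℤ) (a b c : ℕ) (ha : 0 < a) (hb : 0 < b)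
    (h1 : 0 ≤ u1 ∧ u1 ≤ M - 2) (h2 : 0 ≤ u2 ∧ u2 ≤ M - 2) (h3 : 0 ≤ u3 ∧ u3 ≤ M - 2)
    (h : (u1 ≠ 0 ∧ u1 ≠ M - 2) ∨ (u2 ≠ 0 ∧ u2 ≠ M - 2)) :
    a * (u1 * (u1 + 2 - M)) + b * (u2 * (u2 + 2 - M)) + c * (u3 * (u3 + 2 - M)) < 0 := by
  have ha' : (0 : ℤ) < a := by exact_mod_cast ha
  have hb' : (0 : ℤ) < b := by exact_mod_cast hb
  have hc' : (0 : ℤ) ≤ c := by positivity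
  have t1 := mul_nonpos_of_nonneg_of_nonpos ha'.le (term_nonpos M u1 h1.1 h1.2)
  have t2 := mul_nonpos_of_nonneg_of_nonpos hb'.le (term_nonpos M u2 h2.1 h2.2)
  have t3 := mul_nonpos_of_nonneg_of_nonpos hc' (term_nonpos M u3 h3.1 h3.2)
  rcases h with h | h
  · have : u1 * (u1 + 2 - M) < 0 := mul_neg_of_pos_of_neg (by omega) (by omega)
    have := mul_neg_of_pos_of_neg ha' this
    linarith
  · have : u2 * (u2 + 2 - M) < 0 := mul_neg_of_pos_of_neg (by omega) (by omega)
    have := mul_neg_of_pos_of_neg hb' this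
    linarith

lemma exists_u (M : ℤ) (hM : 30 < M) (a b c : ℕ) (ha : 0 < a) (hb : 0 < b) :
    ∃ u1 u2 u3 n : ℤ, n < 0 ∧
      2 * M * n = a * (u1 * (u1 + 2 - M)) + b * (u2 * (u2 + 2 - M)) + c * (u3 * (u3 + 2 - M)) ∧
      (2 ∣ M → 2 ∣ u1 ∧ 2 ∣ u2 ∧ 2 ∣ u3) := by
  have fin : ∀ u1 u2 u3 : ℤ, (0 ≤ u1 ∧ u1 ≤ M - 2) → (0 ≤ u2 ∧ u2 ≤ M - 2) →
      (0 ≤ u3 ∧ u3 ≤ M - 2) → ((u1 ≠ 0 ∧ u1 ≠ M - 2) ∨ (u2 ≠ 0 ∧ u2 ≠ M - 2)) →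
      (2 * M ∣ a * (u1 * (u1 + 2 - M)) + b * (u2 * (u2 + 2 - M)) + c * (u3 * (u3 + 2 - M))) →
      (2 ∣ M → 2 ∣ u1 ∧ 2 ∣ u2 ∧ 2 ∣ u3) →
      ∃ u1 u2 u3 n : ℤ, n < 0 ∧
      2 * M * n = a * (u1 * (u1 + 2 - M)) + b * (u2 * (u2 + 2 - M)) + c * (u3 * (u3 + 2 - M)) ∧
      (2 ∣ M → 2 ∣ u1 ∧ 2 ∣ u2 ∧ 2 ∣ u3) := by
    intro u1 u2 u3 h1 h2 h3 h hd h2'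
    obtain ⟨n, hn⟩ := hd
    refine ⟨u1, u2, u3, n, ?_, hn.symm, h2'⟩
    have := sum_neg M u1 u2 u3 a b c ha hb h1 h2 h3 h
    rw [hn] at this
    by_contra hc
    have := mul_nonneg (show (0 : ℤ) ≤ 2 * M by linarith) (not_lt.mp hc)
    linarith
  rcases Int.even_or_odd' M with ⟨k, hk | hk⟩
  · -- even case
    obtain ⟨K, rfl⟩ : ∃ K : ℕ, k = K := ⟨k.toNat, by omega⟩
    obtain ⟨x, y, z, hd, hnt, -⟩ := key_all K (by omega) a b c
    have hK0 : (0 : ℤ) < K := by omega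
    have red : ∀ v : ℤ, ∃ w q : ℤ, v = w + K * q ∧ 0 ≤ w ∧ w ≤ K - 1 ∧
        (w = 0 → (K : ℤ) ∣ v) ∧ (w = K - 1 → (K : ℤ) ∣ v + 1) := by
      intro v
      refine ⟨v % K, v / K, (Int.emod_add_mul_ediv v K).symm, Int.emod_nonneg _ hK0.ne',
        by have := Int.emod_lt_of_pos v hK0; omega, Int.dvd_of_emod_eq_zero, ?_⟩
      intro h
      have := (Int.emod_add_mul_ediv v K)
      exact ⟨v / K + 1, by rw [h] at this; linarith⟩
    obtain ⟨x', qx, ex, x0, x1, x2, x3⟩ := red x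
    obtain ⟨y', qy, ey, y0, y1, y2, y3⟩ := red y
    obtain ⟨z', qz, ez, z0, z1, z2, z3⟩ := red z
    refine fin (2 * x') (2 * y') (2 * z') (by omega) (by omega) (by omega) ?_ ?_ ?_
    · rcases hnt with h | h
      · left
        exact ⟨fun h' => h.1 (x2 (by omega)), fun h' => h.2 (x3 (by omega))⟩
      · right
        exact ⟨fun h' => h.1 (y2 (by omega)), fun h' => h.2 (y3 (by omega))⟩
    · obtain ⟨e, he⟩ := hd
      refine ⟨e - a * (x' + 2 * x' * qx + K * qx ^ 2 + qx) - b * (y' + 2 * y' * qy + K * qy ^ 2 + qy)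
        - c * (z' + 2 * z' * qz + K * qz ^ 2 + qz), ?_⟩
      rw [ex, ey, ez] at he
      rw [hk]
      linear_combination 4 * he
    · intro _
      exact ⟨dvd_mul_right _ _, dvd_mul_right _ _, dvd_mul_right _ _⟩
  · obtain ⟨K, hKM⟩ : ∃ K : ℕ, M = K := ⟨M.toNat, by omega⟩
    obtain ⟨x, y, z, hd, hnt, ox, oy, oz⟩ := key_all K (by omega) a b c
    rw [← hKM] at hd hnt ox oy oz
    have hK0 : (0 : ℤ) < M := by omega
    have hco : IsCoprime M 2 := ⟨1, -k, by rw [hk]; ring⟩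
    have red : ∀ v : ℤ, ¬ M ∣ 2 * v + 1 → ∃ w q : ℤ, 2 * v = w + M * q ∧ 0 ≤ w ∧ w ≤ M - 2 ∧
        (w = 0 → M ∣ v) ∧ (w = M - 2 → M ∣ v + 1) := by
      intro v hv
      have key := (Int.emod_add_mul_ediv (2 * v) M)
      refine ⟨(2 * v) % M, (2 * v) / M, key.symm, Int.emod_nonneg _ hK0.ne', ?_, ?_, ?_⟩
      · have := Int.emod_lt_of_pos (2 * v) hK0
        have h : (2 * v) % M ≠ M - 1 := by
          intro h
          rw [h] at key
          exact hv ⟨2 * v / M + 1, by linarith⟩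
        omega
      · intro h
        exact hco.dvd_of_dvd_mul_left (Int.dvd_of_emod_eq_zero h)
      · intro h
        rw [h] at key
        exact hco.dvd_of_dvd_mul_left ⟨2 * v / M + 1, by linarith⟩
    obtain ⟨x', qx, ex, x0, x1, x2, x3⟩ := red x ox
    obtain ⟨y', qy, ey, y0, y1, y2, y3⟩ := red y oy
    obtain ⟨z', qz, ez, z0, z1, z2, z3⟩ := red z oz
    refine fin x' y' z' ⟨x0, x1⟩ ⟨y0, y1⟩ ⟨z0, z1⟩ ?_ ?_ ?_
    · rcases hnt with h | h
      · left
        exact ⟨fun h' => h.1 (x2 h'), fun h' => h.2 (x3 h')⟩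
      · right
        exact ⟨fun h' => h.1 (y2 h'), fun h' => h.2 (y3 h')⟩
    · apply IsCoprime.mul_dvd hco.symm
      · have ev : ∀ u : ℤ, (2 : ℤ) ∣ u * (u + 2 - M) := by
          intro u
          rcases Int.even_or_odd' u with ⟨t, ht | ht⟩
          · exact ⟨t * (u + 2 - M), by rw [ht]; ring⟩
          · exact ⟨u * (t + 1 - k), by rw [ht, hk]; ring⟩
        exact dvd_add (dvd_add ((ev _).mul_left _) ((ev _).mul_left _)) ((ev _).mul_left _)
      · obtain ⟨e, he⟩ := hd
        have cg : ∀ v w q : ℤ, 2 * v = w + M * q →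
            w * (w + 2 - M) = 4 * (v * (v + 1)) + M * (-(4 * v * q) + M * q ^ 2 - 2 * q - w) := by
          intro v w q h
          have : w = 2 * v - M * q := by linarith
          rw [this]; ring
        rw [cg x x' qx ex, cg y y' qy ey, cg z z' qz ez]
        exact ⟨4 * e + a * (-(4 * x * qx) + M * qx ^ 2 - 2 * qx - x')
          + b * (-(4 * y * qy) + M * qy ^ 2 - 2 * qy - y')
          + c * (-(4 * z * qz) + M * qz ^ 2 - 2 * qz - z'), by linear_combination 4 * he⟩
    · intro h; omega

/-- Hensel: a quadratic which is linear modulo `p` has a root. -/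
lemma hensel_quad (p : ℕ) [Fact p.Prime] (α β γ : ℤ_[p]) (hα : ‖α‖ < 1) (hβ : ‖β‖ = 1) :
    ∃ x : ℤ_[p], α * x ^ 2 + β * x + γ = 0 := by
  obtain ⟨w, hw⟩ : ∃ w, β * w = 1 := (PadicInt.isUnit_iff.mpr hβ).exists_right_inv
  set P : Polynomial ℤ_[p] :=
    Polynomial.C α * Polynomial.X ^ 2 + Polynomial.C β * Polynomial.X + Polynomial.C γ with hP
  have ev : ∀ x, P.eval x = α * x ^ 2 + β * x + γ := by intro x; simp [hP]
  have dv : ∀ x, P.derivative.eval x = β + α * (2 * x) := by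
    intro x; simp [hP]; ring
  have e1 : P.eval (-(γ * w)) = α * (γ * w) ^ 2 := by
    rw [ev]; linear_combination -γ * hw
  have lt : ∀ y : ℤ_[p], ‖α * y‖ < 1 := by
    intro y
    rw [norm_mul]
    calc ‖α‖ * ‖y‖ ≤ ‖α‖ * 1 := by gcongr; exact PadicInt.norm_le_one y
      _ < 1 := by linarith
  have e2 : ‖P.derivative.eval (-(γ * w))‖ = 1 := by
    rw [dv, PadicInt.norm_add_eq_max_of_ne, hβ, max_eq_left (lt _).le]
    rw [hβ]; exact (lt _).ne'
  obtain ⟨x, hx, -⟩ := hensels_lemma (p := p) (F := P) (a := -(γ * w)) (by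
    simp only [Polynomial.coe_aeval_eq_eval] at *
    rw [e1, e2, one_pow]; exact lt _)
  refine ⟨x, ?_⟩
  rw [← ev]
  simpa using hx

lemma norm_one_of_not_dvd (p : ℕ) [Fact p.Prime] (k : ℤ) (h : ¬ (p : ℤ) ∣ k) :
    ‖(k : ℤ_[p])‖ = 1 := by
  have h1 := PadicInt.norm_le_one (k : ℤ_[p])
  have h2 : ¬ ‖(k : ℤ_[p])‖ < 1 := by rwa [PadicInt.norm_int_lt_one_iff_dvd]
  exact le_antisymm h1 (not_lt.mp h2)

/-- Universality of one term at primes dividing `M` (except for `p = 2`, `M ≡ 2 mod 4`). -/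
lemma local_univ (p : ℕ) [hp : Fact p.Prime] (M n : ℤ) (a : ℕ) (hpM : (p : ℤ) ∣ M)
    (h4 : p = 2 → 4 ∣ M) (ha : ¬ p ∣ a) :
    ∃ x : ℤ_[p], (a : ℤ_[p]) * ((M : ℤ_[p]) * x ^ 2 - ((M : ℤ_[p]) - 2) * x) = 2 * n := by
  have haZ : ¬ (p : ℤ) ∣ (a : ℤ) := by rwa [Int.natCast_dvd_natCast]
  have hpZ : Prime (p : ℤ) := Nat.prime_iff_prime_int.mp hp.out
  by_cases h2 : p = 2
  · subst h2
    obtain ⟨k, rfl⟩ := h4 rfl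
    obtain ⟨x, hx⟩ := hensel_quad 2 ((a * (2 * k) : ℤ) : ℤ_[2])
      ((-(a * (2 * k - 1)) : ℤ) : ℤ_[2]) ((-n : ℤ) : ℤ_[2])
      (by rw [PadicInt.norm_int_lt_one_iff_dvd]; exact ⟨a * k, by push_cast; ring⟩)
      (by
        apply norm_one_of_not_dvd
        rw [dvd_neg, hpZ.dvd_mul]
        push_cast at *
        rintro (h | h)
        · exact haZ h
        · omega)
    refine ⟨x, ?_⟩
    push_cast at *
    linear_combination 2 * hx
  · obtain ⟨x, hx⟩ := hensel_quad p ((a * M : ℤ) : ℤ_[p])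
      ((-(a * (M - 2)) : ℤ) : ℤ_[p]) ((-(2 * n) : ℤ) : ℤ_[p])
      (by rw [PadicInt.norm_int_lt_one_iff_dvd]; exact hpM.mul_left _)
      (by
        apply norm_one_of_not_dvd
        rw [dvd_neg, hpZ.dvd_mul]
        rintro (h | h)
        · exact haZ h
        · have : (p : ℤ) ∣ 2 := by
            have := dvd_sub hpM h
            simpa using this
          have := Int.natCast_dvd_natCast.mp (by simpa using this : (p : ℤ) ∣ ((2 : ℕ) : ℤ))
          exact h2 ((Nat.prime_dvd_prime_iff_eq hp.out Nat.prime_two).mp this))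
    refine ⟨x, ?_⟩
    push_cast at *
    linear_combination hx

lemma local_rep (p : ℕ) [hp : Fact p.Prime] (M n u1 u2 u3 : ℤ) (a b c : ℕ)
    (hg : Nat.gcd (Nat.gcd a b) c = 1)
    (hn : 2 * M * n = a * (u1 * (u1 + 2 - M)) + b * (u2 * (u2 + 2 - M))
      + c * (u3 * (u3 + 2 - M)))
    (he : 2 ∣ M → 2 ∣ u1 ∧ 2 ∣ u2 ∧ 2 ∣ u3) :
    ∃ x y z : ℤ_[p],
      (a : ℤ_[p]) * ((M : ℤ_[p]) * x ^ 2 - ((M : ℤ_[p]) - 2) * x) +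
      (b : ℤ_[p]) * ((M : ℤ_[p]) * y ^ 2 - ((M : ℤ_[p]) - 2) * y) +
      (c : ℤ_[p]) * ((M : ℤ_[p]) * z ^ 2 - ((M : ℤ_[p]) - 2) * z) = 2 * n := by
  by_cases hpM : (p : ℤ) ∣ M
  · by_cases h4 : p = 2 → 4 ∣ M
    · by_cases ha : p ∣ a
      · by_cases hb : p ∣ b
        · have hc : ¬ p ∣ c := by
            intro hc
            have := Nat.dvd_gcd (Nat.dvd_gcd ha hb) hc
            rw [hg] at this
            exact hp.out.one_lt.ne' (Nat.dvd_one.mp this)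
          obtain ⟨x, hx⟩ := local_univ p M n c hpM h4 hc
          exact ⟨0, 0, x, by linear_combination hx⟩
        · obtain ⟨x, hx⟩ := local_univ p M n b hpM h4 hb
          exact ⟨0, x, 0, by linear_combination hx⟩
      · obtain ⟨x, hx⟩ := local_univ p M n a hpM h4 ha
        exact ⟨x, 0, 0, by linear_combination hx⟩
    · push Not at h4
      obtain ⟨rfl, h4⟩ := h4
      obtain ⟨⟨v1, rfl⟩, ⟨v2, rfl⟩, ⟨v3, rfl⟩⟩ := he (by exact_mod_cast hpM)
      obtain ⟨k, rfl⟩ := hpM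
      push_cast at *
      have hk : ¬ ((2 : ℕ) : ℤ) ∣ k := by
        push_cast
        rintro ⟨t, rfl⟩
        exact h4 ⟨t, by ring⟩
      obtain ⟨w, hw⟩ : ∃ w, (k : ℤ_[2]) * w = 1 :=
        (PadicInt.isUnit_iff.mpr (norm_one_of_not_dvd 2 k hk)).exists_right_inv
      have hn' : k * n = a * (v1 * (v1 + 1 - k)) + b * (v2 * (v2 + 1 - k))
          + c * (v3 * (v3 + 1 - k)) := by linarith
      have hn2 : (k : ℤ_[2]) * n = a * (v1 * (v1 + 1 - k)) + b * (v2 * (v2 + 1 - k))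
          + c * (v3 * (v3 + 1 - k)) := by exact_mod_cast congrArg (Int.cast : ℤ → ℤ_[2]) hn'
      refine ⟨v1 * w, v2 * w, v3 * w, ?_⟩
      linear_combination -2 * w * hn2 + (2 * n + 2 * w * (a * v1 ^ 2 + b * v2 ^ 2 + c * v3 ^ 2)) * hw
  · obtain ⟨w, hw⟩ : ∃ w, (M : ℤ_[p]) * w = 1 :=
      (PadicInt.isUnit_iff.mpr (norm_one_of_not_dvd p M hpM)).exists_right_inv
    have hn2 : 2 * (M : ℤ_[p]) * n = a * (u1 * (u1 + 2 - M)) + b * (u2 * (u2 + 2 - M))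
        + c * (u3 * (u3 + 2 - M)) := by exact_mod_cast congrArg (Int.cast : ℤ → ℤ_[p]) hn
    refine ⟨u1 * w, u2 * w, u3 * w, ?_⟩
    linear_combination -w * hn2 + (2 * n + w * (a * u1 ^ 2 + b * u2 ^ 2 + c * u3 ^ 2)) * hw

lemma poly_nonneg (m x : ℤ) (hm : 4 < m) : 0 ≤ (m - 2) * x ^ 2 - (m - 4) * x := by
  rcases le_or_gt x 0 with h | h
  · nlinarith [mul_nonneg (show (0 : ℤ) ≤ m - 4 by linarith) (neg_nonneg.mpr h), sq_nonneg x]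
  · nlinarith [mul_nonneg (mul_nonneg (show (0 : ℤ) ≤ m - 2 by linarith) h.le)
      (show (0 : ℤ) ≤ x - 1 by omega)]


/-- There is an absolute constant `C` such that for every integer `m > C`, no primitive
ternary `m`-gonal form `a·p_m(x) + b·p_m(y) + c·p_m(z)` is regular, where regularity means:
every rational number represented over `ℤ_p` for all primes `p` and over `ℝ` is
represented over `ℤ`.  (All representation conditions are stated with the denominator `2`
of `p_m` cleared.) -/
theorem no_regular_ternary_polygonal_forms :
    ∃ C : ℕ, ∀ m : ℤ, (C : ℤ) < m → ∀ a b c : ℕ,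
      0 < a → 0 < b → 0 < c → Nat.gcd (Nat.gcd a b) c = 1 →
      ¬ (∀ n : ℚ,
        ((∀ (p : ℕ) [Fact p.Prime], ∃ x y z : ℤ_[p],
            (((a : ℤ_[p]) * (((m : ℤ_[p]) - 2) * x ^ 2 - ((m : ℤ_[p]) - 4) * x) +
              (b : ℤ_[p]) * (((m : ℤ_[p]) - 2) * y ^ 2 - ((m : ℤ_[p]) - 4) * y) +
              (c : ℤ_[p]) * (((m : ℤ_[p]) - 2) * z ^ 2 - ((m : ℤ_[p]) - 4) * z) : ℤ_[p]) : ℚ_[p])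
              = 2 * (n : ℚ_[p])) ∧
          (∃ x y z : ℝ,
            (a : ℝ) * (((m : ℝ) - 2) * x ^ 2 - ((m : ℝ) - 4) * x) +
              (b : ℝ) * (((m : ℝ) - 2) * y ^ 2 - ((m : ℝ) - 4) * y) +
              (c : ℝ) * (((m : ℝ) - 2) * z ^ 2 - ((m : ℝ) - 4) * z) = 2 * (n : ℝ))) →
        (∃ x y z : ℤ,
          ((a * ((m - 2) * x ^ 2 - (m - 4) * x) +
            b * ((m - 2) * y ^ 2 - (m - 4) * y) +
            c * ((m - 2) * z ^ 2 - (m - 4) * z) : ℤ) : ℚ) = 2 * n)) := by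
  refine ⟨40, fun m hm a b c ha hb hc hg hreg => ?_⟩
  push_cast at hm
  obtain ⟨u1, u2, u3, n, hn0, hn, he⟩ := exists_u (m - 2) (by linarith) a b c ha hb
  have hr := hreg (n : ℚ)
  apply absurd (hr ⟨?_, ?_⟩)
  · rintro ⟨x, y, z, h⟩
    have h' : (a * ((m - 2) * x ^ 2 - (m - 4) * x) + b * ((m - 2) * y ^ 2 - (m - 4) * y) +
            c * ((m - 2) * z ^ 2 - (m - 4) * z) : ℤ) = 2 * n := by exact_mod_cast h
    have t1 := mul_nonneg (Int.natCast_nonneg a) (poly_nonneg m x (by linarith))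
    have t2 := mul_nonneg (Int.natCast_nonneg b) (poly_nonneg m y (by linarith))
    have t3 := mul_nonneg (Int.natCast_nonneg c) (poly_nonneg m z (by linarith))
    linarith
  · intro p hp
    obtain ⟨x, y, z, h⟩ := local_rep p (m - 2) n u1 u2 u3 a b c hg hn he
    refine ⟨x, y, z, ?_⟩
    have h' : (a : ℤ_[p]) * (((m : ℤ_[p]) - 2) * x ^ 2 - ((m : ℤ_[p]) - 4) * x) +
        (b : ℤ_[p]) * (((m : ℤ_[p]) - 2) * y ^ 2 - ((m : ℤ_[p]) - 4) * y) +
        (c : ℤ_[p]) * (((m : ℤ_[p]) - 2) * z ^ 2 - ((m : ℤ_[p]) - 4) * z) = 2 * n := by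
      push_cast at h
      linear_combination h
    rw [h']
    push_cast
    rfl
  · have hM : ((m : ℝ) - 2) ≠ 0 := by
      have : (40 : ℝ) < m := by exact_mod_cast hm
      linarith
    obtain ⟨w, hw⟩ : ∃ w, ((m : ℝ) - 2) * w = 1 := ⟨_, mul_inv_cancel₀ hM⟩
    have hn2 : 2 * ((m : ℝ) - 2) * n = a * (u1 * (u1 + 2 - (m - 2)))
        + b * (u2 * (u2 + 2 - (m - 2))) + c * (u3 * (u3 + 2 - (m - 2))) := by
      exact_mod_cast congrArg (Int.cast : ℤ → ℝ) hn
    refine ⟨u1 * w, u2 * w, u3 * w, ?_⟩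
    push_cast
    linear_combination -w * hn2 + (2 * n + w * (a * u1 ^ 2 + b * u2 ^ 2 + c * u3 ^ 2)) * hw
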